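/- Let X be a countably infinite Hausdorff Fréchet space with no isolated points. Then nwd(X) is weakly selective: for every Y ⊆ X that is not nowhere dense and every partition {N_n : n ∈ ω} of Y into nowhere dense sets, there is B ⊆ Y that is not nowhere dense and satisfies |B ∩ N_n| ≤ 1 for every n. Consequently, ED ≰_K nwd(X)↾Y for every Y that is not nowhere dense. -/

import Mathlib

open Cardinal Set

/-- An ideal on a (countably infinite) set: contains finite sets, not the whole set,
closed under subsets and finite unions. -/
def IsIdeal {α : Type*} (I : Set (Set α)) : Prop :=
  (∀ A : Set α, A.Finite → A ∈ I) ∧ (Set.univ ∉ I) ∧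
    (∀ A B : Set α, A ∈ I → B ⊆ A → B ∈ I) ∧
    (∀ A B : Set α, A ∈ I → B ∈ I → A ∪ B ∈ I)

/-- `J ≤_K I`: there is a function from the underlying set of `I` to that of `J`
pulling members of `J` back into `I`. -/
def KatetovLE {α β : Type*} (J : Set (Set β)) (I : Set (Set α)) : Prop :=
  ∃ f : α → β, ∀ A ∈ J, f ⁻¹' A ∈ I

def FiniteToOne {α β : Type*} (f : α → β) : Prop := ∀ b : β, (f ⁻¹' {b}).Finite

/-- `J ≤_KB I`: Katětov-Blass order (finite-to-one witness). -/
def KatetovBlassLE {α β : Type*} (J : Set (Set β)) (I : Set (Set α)) : Prop :=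
  ∃ f : α → β, FiniteToOne f ∧ ∀ A ∈ J, f ⁻¹' A ∈ I

/-- The restriction `I ↾ X`, as an ideal on the subtype `X`. -/
def restrictIdeal {α : Type*} (I : Set (Set α)) (X : Set α) : Set (Set ↥X) :=
  {A : Set ↥X | (Subtype.val '' A) ∈ I}

/-- The ideal generated by a family `G` together with the finite sets. -/
def genIdeal {α : Type*} (G : Set (Set α)) : Set (Set α) :=
  {A | ∃ (S : Finset (Set α)) (F : Set α), ↑S ⊆ G ∧ F.Finite ∧ A ⊆ F ∪ ⋃₀ ↑S}

/-- Generators of the eventually different ideal: columns and graphs of functions. -/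
def EDGenerators : Set (Set (ℕ × ℕ)) :=
  {C | ∃ n : ℕ, C = {p : ℕ × ℕ | p.1 = n}} ∪
    {G | ∃ f : ℕ → ℕ, G = {p : ℕ × ℕ | p.2 = f p.1}}

/-- The eventually different ideal on `ω × ω`. -/
def ED : Set (Set (ℕ × ℕ)) := genIdeal EDGenerators

/-- Generators of `fin × fin`: columns and regions under graphs. -/
def FinFinGenerators : Set (Set (ℕ × ℕ)) :=
  {C | ∃ n : ℕ, C = {p : ℕ × ℕ | p.1 = n}} ∪
    {D | ∃ f : ℕ → ℕ, D = {p : ℕ × ℕ | p.2 ≤ f p.1}}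

/-- The ideal `fin × fin` on `ω × ω`. -/
def FinTimesFin : Set (Set (ℕ × ℕ)) := genIdeal FinFinGenerators

def Delta : Set (ℕ × ℕ) := {p : ℕ × ℕ | p.2 ≤ p.1}

/-- `ED_fin`, the restriction of `ED` to `Δ = {(n,m) : m ≤ n}`. -/
def EDfin : Set (Set ↥Delta) := restrictIdeal ED Delta

/-- The ideal of nowhere dense subsets of the rationals. -/
def nwdQ : Set (Set ℚ) := {A : Set ℚ | IsNowhereDense A}

/-- The copy of a family of subsets of `α` inside the Cantor space `α → Bool`
(via characteristic functions). -/
def cantorCopy {α : Type*} (I : Set (Set α)) : Set (α → Bool) :=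
  {x : α → Bool | {a : α | x a = true} ∈ I}

def IsUltrafilterSet (U : Set (Set ℕ)) : Prop :=
  Set.univ ∈ U ∧ ∅ ∉ U ∧ (∀ A B : Set ℕ, A ∈ U → A ⊆ B → B ∈ U) ∧
    (∀ A B : Set ℕ, A ∈ U → B ∈ U → A ∩ B ∈ U) ∧
    (∀ A : Set ℕ, A ∈ U ∨ (Set.univ \ A) ∈ U)

def NonprincipalUF (U : Set (Set ℕ)) : Prop := ∀ A : Set ℕ, A.Finite → A ∉ U

/-- The dual ideal `U*` of an ultrafilter `U`. -/
def dualIdeal (U : Set (Set ℕ)) : Set (Set ℕ) := {A : Set ℕ | Set.univ \ A ∈ U}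

/-- `U` is a Ramsey ultrafilter. -/
def IsRamseyUF (U : Set (Set ℕ)) : Prop :=
  ∀ P : ℕ → Set ℕ, Pairwise (Function.onFun Disjoint P) → (⋃ n, P n) = Set.univ →
    (∀ n, P n ∉ U) → ∃ A ∈ U, ∀ n, (A ∩ P n).Subsingleton

def IsTight (I : Set (Set ℕ)) : Prop :=
  ∀ X : ℕ → Set ℕ, (∀ n, X n ∉ I) → ∃ Y ∈ I, ∀ n, (Y ∩ X n).Infinite

def IsPIdeal (I : Set (Set ℕ)) : Prop :=
  ∀ A : ℕ → Set ℕ, (∀ n, A n ∈ I) → ∃ B ∈ I, ∀ n, (A n \ B).Finite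

def IsPMinus (I : Set (Set ℕ)) : Prop :=
  ∀ X : Set ℕ, X ∉ I → ∀ Xs : ℕ → Set ℕ, (∀ n, Xs n ⊆ X) → (∀ n, X \ Xs n ∈ I) →
    ∃ Y : Set ℕ, Y ∉ I ∧ ∀ n, (Y \ Xs n).Finite

def IsQPlus (I : Set (Set ℕ)) : Prop :=
  ∀ X : Set ℕ, X ∉ I → ∀ P : ℕ → Set ℕ, (∀ n, (P n).Finite) →
    Pairwise (Function.onFun Disjoint P) → (⋃ n, P n) = X →
    ∃ A : Set ℕ, A ∉ I ∧ A ⊆ X ∧ ∀ n, (A ∩ P n).Subsingleton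

def AlmostSubset (A B : Set ℕ) : Prop := (A \ B).Finite

/-- The tower number 𝔱. -/
noncomputable def towerNumber : Cardinal :=
  sInf {c : Cardinal | ∃ T : Set (Set ℕ),
    (∀ A ∈ T, A.Infinite) ∧
    (∀ A ∈ T, ∀ B ∈ T, AlmostSubset A B ∨ AlmostSubset B A) ∧
    (¬ ∃ A : Set ℕ, A.Infinite ∧ ∀ B ∈ T, AlmostSubset A B) ∧
    Cardinal.mk T = c}

/-- cov(M): covering number of the meager ideal of Baire space. -/
noncomputable def covM : Cardinal :=
  sInf {c : Cardinal | ∃ F : Set (Set (ℕ → ℕ)),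
    (∀ A ∈ F, IsMeagre A) ∧ ⋃₀ F = Set.univ ∧ Cardinal.mk F = c}

/-- The dominating number 𝔡. -/
noncomputable def dNumber : Cardinal :=
  sInf {c : Cardinal | ∃ D : Set (ℕ → ℕ),
    (∀ f : ℕ → ℕ, ∃ g ∈ D, ∀ᶠ n in Filter.atTop, f n ≤ g n) ∧ Cardinal.mk D = c}

/-- The cofinality of an ideal: least size of a cofinal subfamily. -/
noncomputable def idealCof (I : Set (Set ℕ)) : Cardinal :=
  sInf {c : Cardinal | ∃ C : Set (Set ℕ), C ⊆ I ∧ (∀ A ∈ I, ∃ B ∈ C, A ⊆ B) ∧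
    Cardinal.mk C = c}

/-- An increasing interval partition of ω, given by its sequence of endpoints. -/
structure IncIntervalPartition where
  e : ℕ → ℕ
  zero : e 0 = 0
  mono : StrictMono e
  incr : ∀ n : ℕ, e (n + 1) - e n < e (n + 2) - e (n + 1)

def IncIntervalPartition.block (P : IncIntervalPartition) (n : ℕ) : Set ℕ :=
  Set.Ico (P.e n) (P.e (n + 1))

/-- A selector of an interval partition: a set meeting each block in exactly one point. -/
def IsSelector (P : IncIntervalPartition) (S : Set ℕ) : Prop :=
  ∀ n : ℕ, ∃! x : ℕ, x ∈ S ∩ P.block n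

/-- The ideal `ED_P` generated by the selectors of `P` (and the finite sets). -/
def EDP (P : IncIntervalPartition) : Set (Set ℕ) := genIdeal {S : Set ℕ | IsSelector P S}

/-- A Fréchet space: closure points are limits of sequences. -/
def IsFrechet (α : Type*) [TopologicalSpace α] : Prop :=
  ∀ (a : α) (Y : Set α), a ∈ closure Y →
    ∃ u : ℕ → α, (∀ n, u n ∈ Y) ∧ Filter.Tendsto u Filter.atTop (nhds a)

/-- Zero-dimensional: the clopen sets form a basis. -/
def ZeroDimensional (α : Type*) [TopologicalSpace α] : Prop :=
  TopologicalSpace.IsTopologicalBasis {U : Set α | IsClopen U}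

/-- A local π-base at a point. -/
def IsLocalPiBase {α : Type*} [TopologicalSpace α] (B : Set (Set α)) (b : α) : Prop :=
  (∀ U ∈ B, IsOpen U ∧ U.Nonempty) ∧
    ∀ V : Set α, IsOpen V → b ∈ V → ∃ U ∈ B, U ⊆ V

/-- Every point has uncountable π-character. -/
def UncountablePiCharEverywhere (α : Type*) [TopologicalSpace α] : Prop :=
  ∀ (b : α) (B : Set (Set α)), IsLocalPiBase B b → ¬ B.Countable

/-- An independent family on ω. -/
def IsIndepFamily (B : Set (Set ℕ)) : Prop :=
  (∀ A ∈ B, A.Infinite) ∧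
    ∀ F G : Finset (Set ℕ), ↑F ⊆ B → ↑G ⊆ B → Disjoint F G →
      ((⋂ A ∈ F, A) ∩ ⋂ A ∈ G, (Set.univ \ A)).Infinite

def SeparatesPointsFam (B : Set (Set ℕ)) : Prop :=
  ∀ m n : ℕ, m ≠ n → ∃ A ∈ B, m ∈ A ∧ n ∉ A

/-- The envelope of an independent family: finite Boolean combinations. -/
def envSets (B : Set (Set ℕ)) : Set (Set ℕ) :=
  {V : Set ℕ | ∃ F G : Finset (Set ℕ), ↑F ⊆ B ∧ ↑G ⊆ B ∧ Disjoint F G ∧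
    V = (⋂ A ∈ F, A) ∩ ⋂ A ∈ G, (Set.univ \ A)}

/-- The topology on ω generated by the envelope of `B`. -/
def XBtop (B : Set (Set ℕ)) : TopologicalSpace ℕ :=
  TopologicalSpace.generateFrom (envSets B)

/-- The ideal of nowhere dense subsets of the space `X(B)`. -/
def nwdXB (B : Set (Set ℕ)) : Set (Set ℕ) :=
  {A : Set ℕ | @IsNowhereDense ℕ (XBtop B) A}

/-- `non*(ED_fin)`. -/
noncomputable def nonStarEDfin : Cardinal :=
  sInf {c : Cardinal | ∃ H : Set (Set ↥Delta),
    (∀ A ∈ H, A.Infinite) ∧ (∀ A ∈ EDfin, ∃ B ∈ H, (A ∩ B).Finite) ∧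
    Cardinal.mk H = c}

theorem exists_strictMono_comp_of_forall_exists_lt {α : Type*} (ℓ : α → ℕ) (P : ℕ → Set α)
    (h : ∀ i m, ∃ x ∈ P i, m < ℓ x) :
    ∃ b : ℕ → α, (∀ i, b i ∈ P i) ∧ StrictMono (ℓ ∘ b) := by
  choose F hFP hFlt using h
  let b : ℕ → α := fun n => Nat.rec (F 0 0) (fun k x => F (k + 1) (ℓ x)) n
  refine ⟨b, fun i => ?_, strictMono_nat_of_lt_succ fun n => hFlt (n + 1) (ℓ (b n))⟩
  cases i with
  | zero => exact hFP 0 0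
  | succ k => exact hFP (k + 1) (ℓ (b k))

theorem IsNowhereDense.union {α : Type*} [TopologicalSpace α] {s t : Set α}
    (hs : IsNowhereDense s) (ht : IsNowhereDense t) : IsNowhereDense (s ∪ t) := by
  rw [IsNowhereDense, closure_union,
    interior_union_isClosed_of_interior_empty isClosed_closure ht, hs]

theorem isNowhereDense_biUnion_of_finite {ι α : Type*} [TopologicalSpace α] {N : ι → Set α}
    (hN : ∀ i, IsNowhereDense (N i)) {s : Set ι} (hs : s.Finite) :
    IsNowhereDense (⋃ i ∈ s, N i) := by
  induction s, hs using Set.Finite.induction_on with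
  | empty => simp
  | insert _ _ ih => simpa only [Set.biUnion_insert] using (hN _).union ih

/-- A countable cover of a somewhere dense set by nowhere dense sets admits, at every point of the
interior of the closure, a convergent sequence that eventually leaves each member. -/
theorem exists_tendsto_eventually_notMem {α : Type*} [TopologicalSpace α] [T2Space α]
    (hF : IsFrechet α) (hni : ∀ a : α, ¬ IsOpen ({a} : Set α)) {Y : Set α} {N : ℕ → Set α}
    (hN : ∀ n, IsNowhereDense (N n)) {a : α} (ha : a ∈ interior (closure Y)) :
    ∃ u : ℕ → α, (∀ j, u j ∈ Y) ∧ Filter.Tendsto u Filter.atTop (nhds a) ∧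
      ∀ n, ∀ᶠ j in Filter.atTop, ∀ i ≤ n, u j ∉ N i := by
  have hdense : ∀ (n : ℕ) (V : Set α), IsOpen V → (V ∩ interior (closure Y)).Nonempty →
      ∃ y ∈ V ∩ Y, ∀ i ≤ n, y ∉ N i := by
    intro n V hV hne
    by_contra! hcon
    have hVo : IsOpen (V ∩ interior (closure Y)) := hV.inter isOpen_interior
    have hsub : V ∩ interior (closure Y) ⊆ closure (⋃ i ∈ Set.Iic n, N i) := by
      refine (Set.inter_subset_inter_right V interior_subset).trans
        (hV.inter_closure.trans (closure_mono fun y hy => ?_))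
      simpa using hcon y hy
    have := interior_maximal hsub hVo
    rw [isNowhereDense_biUnion_of_finite hN (Set.finite_Iic n)] at this
    exact hne.not_subset_empty this
  have hacl : a ∈ closure (interior (closure Y) \ {a}) := by
    rw [mem_closure_iff]
    intro O hO haO
    by_contra hcon
    refine hni a ?_
    have : O ∩ interior (closure Y) = {a} := by
      ext z
      constructor
      · intro hz
        by_contra hza
        exact hcon ⟨z, hz.1, hz.2, hza⟩
      · rintro rfl
        exact ⟨haO, ha⟩
    exact this ▸ hO.inter isOpen_interior
  obtain ⟨x, hx, hxa⟩ := hF a _ hacl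
  choose V W hVo hWo hxV haW hVW using fun n => t2_separation (show x n ≠ a from (hx n).2)
  have haZ : a ∈ closure (⋃ n, {y | y ∈ V n ∩ Y ∧ ∀ i ≤ n, y ∉ N i}) := by
    rw [mem_closure_iff]
    intro O hO haO
    obtain ⟨n, hn⟩ := (hxa.eventually (hO.mem_nhds haO)).exists
    obtain ⟨y, hy, hyN⟩ := hdense n (O ∩ V n) (hO.inter (hVo n)) ⟨x n, ⟨hn, hxV n⟩, (hx n).1⟩
    exact ⟨y, hy.1.1, Set.mem_iUnion.2 ⟨n, ⟨hy.1.2, hy.2⟩, hyN⟩⟩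
  obtain ⟨u, huZ, hua⟩ := hF a _ haZ
  refine ⟨u, fun j => ?_, hua, fun n => ?_⟩
  · obtain ⟨m, hm⟩ := Set.mem_iUnion.1 (huZ j)
    exact hm.1.2
  · have hev : ∀ᶠ j in Filter.atTop, ∀ m ∈ Set.Iic n, u j ∈ W m :=
      (Filter.eventually_all_finite (Set.finite_Iic n)).2 fun m _ =>
        hua.eventually ((hWo m).mem_nhds (haW m))
    filter_upwards [hev] with j hj i hi
    obtain ⟨m, hm⟩ := Set.mem_iUnion.1 (huZ j)
    refine hm.2 i (hi.trans (le_of_not_ge fun hmn => ?_))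
    exact Set.disjoint_left.1 (hVW m) hm.1.1 (hj m hmn)

theorem exists_selector_not_isNowhereDense {α : Type*} [TopologicalSpace α] [T2Space α]
    [Countable α] (hF : IsFrechet α) (hni : ∀ a : α, ¬ IsOpen ({a} : Set α)) {Y : Set α}
    (hY : ¬ IsNowhereDense Y) {N : ℕ → Set α} (hN : ∀ n, IsNowhereDense (N n))
    (hdisj : Pairwise (Function.onFun Disjoint N)) (hU : (⋃ n, N n) = Y) :
    ∃ B : Set α, B ⊆ Y ∧ ¬ IsNowhereDense B ∧ ∀ n, (B ∩ N n).Subsingleton := by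
  have hne : (interior (closure Y)).Nonempty := Set.nonempty_iff_ne_empty.2 hY
  have : Nonempty (interior (closure Y)) := hne.to_subtype
  choose u huY hua huN using fun a : interior (closure Y) =>
    exists_tendsto_eventually_notMem hF hni hN a.2
  have hlab : ∀ y : α, ∃ n, y ∈ Y → y ∈ N n := by
    intro y
    by_cases hy : y ∈ Y
    · obtain ⟨n, hn⟩ := Set.mem_iUnion.1 (hU.symm ▸ hy)
      exact ⟨n, fun _ => hn⟩
    · exact ⟨0, fun h => absurd h hy⟩
  choose ℓ hℓ using hlab
  have hℓ_eq : ∀ y n, y ∈ N n → ℓ y = n := by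
    intro y n hy
    by_contra hne
    exact Set.disjoint_left.1 (hdisj hne) (hℓ y (hU ▸ Set.mem_iUnion.2 ⟨n, hy⟩)) hy
  obtain ⟨e, he⟩ := exists_surjective_nat (interior (closure Y) × ℕ)
  obtain ⟨b, hb, hmono⟩ := exists_strictMono_comp_of_forall_exists_lt ℓ
    (fun i => u (e i).1 '' Set.Ici (e i).2) fun i m => by
      obtain ⟨j, hj, hjN⟩ :=
        ((Filter.eventually_ge_atTop (e i).2).and (huN (e i).1 m)).exists
      refine ⟨_, ⟨j, hj, rfl⟩, lt_of_not_ge fun hle => ?_⟩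
      exact hjN _ hle (hℓ _ (huY _ j))
  refine ⟨Set.range b, ?_, fun hnwd => ?_, fun n => ?_⟩
  · rintro _ ⟨i, rfl⟩
    obtain ⟨j, -, hj⟩ := hb i
    exact hj ▸ huY _ j
  · have hsub : interior (closure Y) ⊆ closure (Set.range b) := by
      intro a ha
      rw [mem_closure_iff]
      intro O hO haO
      obtain ⟨k, hk⟩ :=
        Filter.eventually_atTop.1 ((hua ⟨a, ha⟩).eventually (hO.mem_nhds haO))
      obtain ⟨i, hi⟩ := he (⟨a, ha⟩, k)
      obtain ⟨j, hj, hjb⟩ := hb i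
      rw [hi] at hj hjb
      exact ⟨b i, hjb ▸ hk j hj, i, rfl⟩
    have := interior_maximal hsub isOpen_interior
    rw [hnwd] at this
    exact hne.not_subset_empty this
  · rintro _ ⟨⟨i, rfl⟩, hi⟩ _ ⟨⟨j, rfl⟩, hj⟩
    rw [hmono.injective ((hℓ_eq _ _ hi).trans (hℓ_eq _ _ hj).symm)]

theorem mem_genIdeal_of_mem {α : Type*} {G : Set (Set α)} {A : Set α} (hA : A ∈ G) :
    A ∈ genIdeal G :=
  ⟨{A}, ∅, by simpa using hA, Set.finite_empty, by simp⟩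

theorem not_katetovLE_ED_of_exists_selector {α : Type*} {I : Set (Set α)} {Y : Set α}
    (hI : ∀ A B : Set α, A ∈ I → B ⊆ A → B ∈ I)
    (hsel : ∀ N : ℕ → Set α, (∀ n, N n ∈ I) → Pairwise (Function.onFun Disjoint N) →
      (⋃ n, N n) = Y → ∃ B : Set α, B ⊆ Y ∧ B ∉ I ∧ ∀ n, (B ∩ N n).Subsingleton) :
    ¬ KatetovLE ED (restrictIdeal I Y) := by
  rintro ⟨f, hf⟩
  obtain ⟨B, hBY, hBI, hB⟩ := hsel (fun n => Subtype.val '' (f ⁻¹' {p | p.1 = n}))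
    (fun n => hf _ (mem_genIdeal_of_mem (Or.inl ⟨n, rfl⟩)))
    (fun m n hmn => (Set.disjoint_image_iff Subtype.val_injective).2 <|
      Set.disjoint_left.2 fun y hm hn => hmn (hm.symm.trans hn))
    (by ext y; simp)
  have hval : ∀ n, ∃ v, ∀ y : Y, y.1 ∈ B → (f y).1 = n → (f y).2 = v := by
    intro n
    by_cases h : ∃ y : Y, y.1 ∈ B ∧ (f y).1 = n
    · obtain ⟨y, hyB, hyn⟩ := h
      refine ⟨(f y).2, fun z hzB hzn => ?_⟩
      rw [Subtype.ext (hB n ⟨hzB, z, hzn, rfl⟩ ⟨hyB, y, hyn, rfl⟩)]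
    · exact ⟨0, fun y hyB hyn => absurd ⟨y, hyB, hyn⟩ h⟩
  choose g hg using hval
  exact hBI <| hI _ _ (hf _ (mem_genIdeal_of_mem (Or.inr ⟨g, rfl⟩)))
    fun y hy => ⟨⟨y, hBY hy⟩, hg _ ⟨y, hBY hy⟩ hy rfl, rfl⟩

/-- `nwd(X)` is weakly selective for a countably infinite Hausdorff
Fréchet space with no isolated points; consequently no restriction of it is
Katětov above `ED`. -/
theorem stmt14 {α : Type} [TopologicalSpace α] [T2Space α] [Countable α] [Infinite α]
    (hF : IsFrechet α) (hni : ∀ a : α, ¬ IsOpen ({a} : Set α)) :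
    (∀ Y : Set α, ¬ IsNowhereDense Y →
      ∀ N : ℕ → Set α, (∀ n, IsNowhereDense (N n)) →
        Pairwise (Function.onFun Disjoint N) → (⋃ n, N n) = Y →
        ∃ B : Set α, B ⊆ Y ∧ ¬ IsNowhereDense B ∧ ∀ n, (B ∩ N n).Subsingleton) ∧
    ∀ Y : Set α, ¬ IsNowhereDense Y →
      ¬ KatetovLE ED (restrictIdeal {A : Set α | IsNowhereDense A} Y) := by
  have hsel : ∀ Y : Set α, ¬ IsNowhereDense Y →
      ∀ N : ℕ → Set α, (∀ n, IsNowhereDense (N n)) →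
        Pairwise (Function.onFun Disjoint N) → (⋃ n, N n) = Y →
        ∃ B : Set α, B ⊆ Y ∧ ¬ IsNowhereDense B ∧ ∀ n, (B ∩ N n).Subsingleton :=
    fun Y hY N hN hdisj hU => exists_selector_not_isNowhereDense hF hni hY hN hdisj hU
  exact ⟨hsel, fun Y hY => not_katetovLE_ED_of_exists_selector
    (fun A B hA hBA => hA.mono hBA) (hsel Y hY)⟩
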